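/- Suppose V̂ satisfies the Bellman equation for π. Then for every 0 ≤ k ≤ N−1 and every real-valued function b of the partial trajectory τ_{0:k} = (S_0, A_0, S_1, …, S_k), the weighted TD error has zero conditional mean: E_π[b(τ_{0:k})·δ_k | S_0 = s] = 0. -/

import Mathlib

open Finset

attribute [local instance] Classical.propDecidable

namespace HCA

/-- A trajectory of horizon `N`: the actions taken at steps `0, …, N-1` and the
states reached after each step (the start state is fixed separately). -/
abbrev Traj (S A : Type*) (N : ℕ) : Type _ := (Fin N → A) × (Fin N → S)

variable {S A : Type*} [Fintype S] [Fintype A] [Nonempty S] [Nonempty A]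

/-- The state `S_k` of a trajectory with start state `s`. -/
def st {N : ℕ} (s : S) (τ : Traj S A N) : ℕ → S
  | 0 => s
  | k + 1 => if h : k < N then τ.2 ⟨k, h⟩ else s

/-- The action `A_k` of a trajectory. -/
noncomputable def ac {N : ℕ} (τ : Traj S A N) (k : ℕ) : A :=
  if h : k < N then τ.1 ⟨k, h⟩ else Classical.arbitrary A

/-- The probability `P_π(τ) = ∏_{k=0}^{N-1} π(A_k|S_k)·P(S_{k+1}|S_k,A_k)` of a
trajectory starting at `s`. -/
noncomputable def trajP (π : S → A → ℝ) (P : S → A → S → ℝ) (s : S) (N : ℕ)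
    (τ : Traj S A N) : ℝ :=
  ∏ k : Fin N, π (st s τ k) (τ.1 k) * P (st s τ k) (τ.1 k) (st s τ (k + 1))

/-- Expectation `E_π[f | S_0 = s]` over trajectories. -/
noncomputable def expct (π : S → A → ℝ) (P : S → A → S → ℝ) (s : S) (N : ℕ)
    (f : Traj S A N → ℝ) : ℝ :=
  ∑ τ : Traj S A N, trajP π P s N τ * f τ

/-- Variance `Var_π(f | S_0 = s)` over trajectories. -/
noncomputable def vr (π : S → A → ℝ) (P : S → A → S → ℝ) (s : S) (N : ℕ)
    (f : Traj S A N → ℝ) : ℝ :=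
  expct π P s N (fun τ => (f τ - expct π P s N f) ^ 2)

/-- Covariance `cov_π(f, g | S_0 = s)` over trajectories. -/
noncomputable def cv (π : S → A → ℝ) (P : S → A → S → ℝ) (s : S) (N : ℕ)
    (f g : Traj S A N → ℝ) : ℝ :=
  expct π P s N (fun τ => (f τ - expct π P s N f) * (g τ - expct π P s N g))

/-- Probability `P_π(E | S_0 = s)` of an event `E` on trajectories. -/
noncomputable def prE (π : S → A → ℝ) (P : S → A → S → ℝ) (s : S) (N : ℕ)
    (E : Traj S A N → Prop) : ℝ :=
  ∑ τ : Traj S A N, if E τ then trajP π P s N τ else 0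

/-- The TD error `δ_k = r(S_k,A_k) + γ·V̂(S_{k+1}) − V̂(S_k)`. -/
noncomputable def td (r : S → A → ℝ) (γ : ℝ) (V : S → ℝ) (s : S) {N : ℕ}
    (τ : Traj S A N) (k : ℕ) : ℝ :=
  r (st s τ k) (ac τ k) + γ * V (st s τ (k + 1)) - V (st s τ k)

/-- `p_k(s'|s,a) = P_π(S_k = s' | S_0 = s, A_0 = a)
  = P_π(A_0 = a, S_k = s' | S_0 = s) / π(a|s)`. -/
noncomputable def pkSA (π : S → A → ℝ) (P : S → A → S → ℝ) (s : S) (N k : ℕ)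
    (a : A) (s' : S) : ℝ :=
  prE π P s N (fun τ => ac τ 0 = a ∧ st s τ k = s') / π s a

/-- `p_k(s'|s) = Σ_a π(a|s)·p_k(s'|s,a)`. -/
noncomputable def pkS (π : S → A → ℝ) (P : S → A → S → ℝ) (s : S) (N k : ℕ)
    (s' : S) : ℝ :=
  ∑ a : A, π s a * pkSA π P s N k a s'

/-- The hindsight probability `p_k(a|s,s')`, defined as
`P_π(A_0 = a, S_k = s' | S_0 = s)/p_k(s'|s)` when `p_k(s'|s) > 0` and `0` otherwise. -/
noncomputable def pkA (π : S → A → ℝ) (P : S → A → S → ℝ) (s : S) (N k : ℕ)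
    (a : A) (s' : S) : ℝ :=
  if 0 < pkS π P s N k s' then
    prE π P s N (fun τ => ac τ 0 = a ∧ st s τ k = s') / pkS π P s N k s'
  else 0

/-- The `N`-step Monte-Carlo advantage estimator
`Â^MC_N(a) = (1(A_0=a)/π(a|s))·Σ_{k=0}^{N−1} γ^k·δ_k`. -/
noncomputable def mcEst (π : S → A → ℝ) (r : S → A → ℝ) (γ : ℝ) (V : S → ℝ)
    (s : S) (N : ℕ) (a : A) (τ : Traj S A N) : ℝ :=
  ((if ac τ 0 = a then (1 : ℝ) else 0) / π s a) * ∑ k ∈ range N, γ ^ k * td r γ V s τ k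

/-- The `N`-step δHCA advantage estimator
`Â^δHCA_N(a) = (1(A_0=a)/π(a|s))·δ_0 + Σ_{k=1}^{N−1} γ^k·(p_k(a|s,S_k)/π(a|s))·δ_k`. -/
noncomputable def dhcaEst (π : S → A → ℝ) (P : S → A → S → ℝ) (r : S → A → ℝ)
    (γ : ℝ) (V : S → ℝ) (s : S) (N : ℕ) (a : A) (τ : Traj S A N) : ℝ :=
  ((if ac τ 0 = a then (1 : ℝ) else 0) / π s a) * td r γ V s τ 0
    + ∑ k ∈ Ico 1 N, γ ^ k * (pkA π P s N k a (st s τ k) / π s a) * td r γ V s τ k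

/-- `V` satisfies the Bellman equation for `π`:
`V(s₀) = Σ_a π(a|s₀)·(r(s₀,a) + γ·Σ_{s'} P(s'|s₀,a)·V(s'))` for every state `s₀`. -/
def IsBellman (π : S → A → ℝ) (P : S → A → S → ℝ) (r : S → A → ℝ) (γ : ℝ)
    (V : S → ℝ) : Prop :=
  ∀ s₀ : S, V s₀ = ∑ a : A, π s₀ a * (r s₀ a + γ * ∑ s' : S, P s₀ a s' * V s')

/-- The conditional second moment `E_π[δ_k² | S_0 = s, S_k = s']`,
defined as `(Σ_{τ : S_k = s'} P_π(τ)·δ_k(τ)²)/p_k(s'|s)`. -/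
noncomputable def sndMom (π : S → A → ℝ) (P : S → A → S → ℝ) (r : S → A → ℝ)
    (γ : ℝ) (V : S → ℝ) (s : S) (N k : ℕ) (s' : S) : ℝ :=
  (∑ τ : Traj S A N, if st s τ k = s' then trajP π P s N τ * (td r γ V s τ k) ^ 2 else 0)
    / pkS π P s N k s'

/-- Append a final action and state to a trajectory. -/
def ext {S A : Type*} {N : ℕ} (τ : Traj S A N) (a : A) (x : S) : Traj S A (N + 1) :=
  (Fin.snoc (α := fun _ => A) τ.1 a, Fin.snoc (α := fun _ => S) τ.2 x)

theorem st_ext_of_le {S A : Type*} {N : ℕ} (s : S) (τ : Traj S A N) (a : A) (x : S)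
    (j : ℕ) (hj : j ≤ N) : st s (ext τ a x) j = st s τ j := by
  cases j with
  | zero => rfl
  | succ j =>
    have h1 : j < N := hj
    have h2 : j < N + 1 := by omega
    simp only [st, h1, h2, dif_pos, ext]
    exact Fin.snoc_castSucc (α := fun _ => S) x τ.2 ⟨j, h1⟩

theorem st_ext_last {S A : Type*} {N : ℕ} (s : S) (τ : Traj S A N) (a : A) (x : S) :
    st s (ext τ a x) (N + 1) = x := by
  have h2 : N < N + 1 := by omega
  simp only [st, h2, dif_pos, ext]
  exact Fin.snoc_last (α := fun _ => S) x τ.2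

theorem ac_ext_of_lt {S A : Type*} [Nonempty A] {N : ℕ} (τ : Traj S A N) (a : A) (x : S)
    (j : ℕ) (hj : j < N) : ac (ext τ a x) j = ac τ j := by
  have h2 : j < N + 1 := by omega
  simp only [ac, hj, h2, dif_pos, ext]
  exact Fin.snoc_castSucc (α := fun _ => A) a τ.1 ⟨j, hj⟩

theorem ac_ext_last {S A : Type*} [Nonempty A] {N : ℕ} (τ : Traj S A N) (a : A) (x : S) :
    ac (ext τ a x) N = a := by
  have h2 : N < N + 1 := by omega
  simp only [ac, h2, dif_pos, ext]
  exact Fin.snoc_last (α := fun _ => A) a τ.1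

theorem trajP_ext {S A : Type*} (π : S → A → ℝ) (P : S → A → S → ℝ) (s : S) (N : ℕ)
    (τ : Traj S A N) (a : A) (x : S) :
    trajP π P s (N + 1) (ext τ a x) =
      trajP π P s N τ * (π (st s τ N) a * P (st s τ N) a x) := by
  have e1 : ∀ k : Fin N, (ext τ a x).1 k.castSucc = τ.1 k := fun k =>
    Fin.snoc_castSucc (α := fun _ => A) a τ.1 k
  have e2 : (ext τ a x).1 (Fin.last N) = a := Fin.snoc_last (α := fun _ => A) a τ.1
  unfold trajP
  rw [Fin.prod_univ_castSucc]
  congr 1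
  · refine Finset.prod_congr rfl fun k _ => ?_
    rw [e1, Fin.val_castSucc, st_ext_of_le s τ a x k k.2.le, st_ext_of_le s τ a x (k + 1) k.2]
  · rw [e2, Fin.val_last, st_ext_of_le s τ a x N le_rfl, st_ext_last]

/-- Summing out the last step. -/
theorem expct_succ {S A : Type*} [Fintype S] [Fintype A]
    (π : S → A → ℝ) (P : S → A → S → ℝ) (s : S) (N : ℕ) (f : Traj S A (N + 1) → ℝ) :
    expct π P s (N + 1) f = expct π P s N (fun τ =>
      ∑ a : A, ∑ x : S, π (st s τ N) a * P (st s τ N) a x * f (ext τ a x)) := by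
  let e : (Traj S A N × (A × S)) ≃ Traj S A (N + 1) :=
    { toFun := fun p => ext p.1 p.2.1 p.2.2
      invFun := fun τ => ((fun i => τ.1 i.castSucc, fun i => τ.2 i.castSucc),
        (τ.1 (Fin.last N), τ.2 (Fin.last N)))
      left_inv := by
        rintro ⟨⟨u, v⟩, a, x⟩
        simp [ext]
      right_inv := by
        rintro ⟨u, v⟩
        refine Prod.ext ?_ ?_
        · exact Fin.snoc_init_self (α := fun _ => A) u
        · exact Fin.snoc_init_self (α := fun _ => S) v }
  unfold expct
  rw [← Equiv.sum_comp e, Fintype.sum_prod_type]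
  refine Finset.sum_congr rfl fun τ _ => ?_
  rw [Fintype.sum_prod_type, Finset.mul_sum]
  refine Finset.sum_congr rfl fun a _ => ?_
  rw [Finset.mul_sum]
  refine Finset.sum_congr rfl fun x _ => ?_
  change trajP π P s (N + 1) (ext τ a x) * f (ext τ a x) = _
  rw [trajP_ext]
  ring

theorem stmt_15 {S A : Type*} [Fintype S] [Fintype A] [Nonempty S] [Nonempty A]
    (π : S → A → ℝ) (P : S → A → S → ℝ) (r : S → A → ℝ) (γ : ℝ)
    (N : ℕ) (s : S)
    (hπpos : ∀ s₀ a, 0 < π s₀ a) (hπsum : ∀ s₀ : S, ∑ a : A, π s₀ a = 1)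
    (hPnn : ∀ s₀ a s', 0 ≤ P s₀ a s') (hPsum : ∀ (s₀ : S) (a : A), ∑ s' : S, P s₀ a s' = 1)
    (hγ0 : 0 ≤ γ) (hγ1 : γ ≤ 1) (hN : 1 ≤ N)
    (V : S → ℝ) (hV : IsBellman π P r γ V)
    (k : ℕ) (hk : k ≤ N - 1) (b : Traj S A N → ℝ)
    (hb : ∀ τ τ' : Traj S A N, (∀ j < k, ac τ j = ac τ' j) →
      (∀ j ≤ k, st s τ j = st s τ' j) → b τ = b τ') :
    expct π P s N (fun τ => b τ * td r γ V s τ k) = 0 := by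
  obtain ⟨M, rfl⟩ : ∃ M, N = k + 1 + M := ⟨N - (k + 1), by omega⟩
  clear hk hN
  induction M with
  | zero =>
    change expct π P s (k + 1) _ = 0
    rw [expct_succ]
    unfold expct
    refine Finset.sum_eq_zero fun τ _ => ?_
    refine mul_eq_zero_of_right _ ?_
    obtain ⟨a₀⟩ := ‹Nonempty A›
    obtain ⟨x₀⟩ := ‹Nonempty S›
    have hb' : ∀ a x, b (ext τ a x) = b (ext τ a₀ x₀) := by
      intro a x
      apply hb
      · intro j hj
        rw [ac_ext_of_lt _ _ _ _ hj, ac_ext_of_lt _ _ _ _ hj]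
      · intro j hj
        rw [st_ext_of_le _ _ _ _ _ hj, st_ext_of_le _ _ _ _ _ hj]
    set y := st s τ k with hy
    set c := b (ext τ a₀ x₀) with hc
    have key : ∀ a : A, ∑ x : S, π y a * P y a x *
        (b (ext τ a x) * td r γ V s (ext τ a x) k) =
        c * (π y a * (r y a + γ * ∑ x : S, P y a x * V x)) - c * V y * π y a := by
      intro a
      have h1 : ∀ x : S, π y a * P y a x * (b (ext τ a x) * td r γ V s (ext τ a x) k) =
          c * π y a * (r y a - V y) * P y a x + c * π y a * γ * (P y a x * V x) := by
        intro x
        rw [hb', td, ac_ext_last, st_ext_last, st_ext_of_le s τ a x k le_rfl, ← hy]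
        ring
      rw [Finset.sum_congr rfl fun x _ => h1 x, Finset.sum_add_distrib, ← Finset.mul_sum,
        ← Finset.mul_sum, hPsum]
      ring
    beta_reduce
    rw [Finset.sum_congr rfl fun a _ => key a, Finset.sum_sub_distrib, ← Finset.mul_sum,
      ← Finset.mul_sum, hπsum, ← hV y]
    ring
  | succ M ih =>
    obtain ⟨a₀⟩ := id ‹Nonempty A›
    obtain ⟨x₀⟩ := id ‹Nonempty S›
    change expct π P s (k + 1 + M + 1) _ = 0
    rw [expct_succ]
    refine Eq.trans ?_ (ih (fun τ => b (ext τ a₀ x₀)) ?_)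
    · congr 1
      funext τ
      set y := st s τ (k + 1 + M) with hy
      have h1 : ∀ a x, b (ext τ a x) * td r γ V s (ext τ a x) k =
          b (ext τ a₀ x₀) * td r γ V s τ k := by
        intro a x
        congr 1
        · apply hb
          · intro j hj
            rw [ac_ext_of_lt (N := k + 1 + M) _ _ _ _ (by omega),
              ac_ext_of_lt (N := k + 1 + M) _ _ _ _ (by omega)]
          · intro j hj
            rw [st_ext_of_le (N := k + 1 + M) _ _ _ _ _ (by omega),
              st_ext_of_le (N := k + 1 + M) _ _ _ _ _ (by omega)]
        · rw [td, td,
              ac_ext_of_lt (N := k + 1 + M) _ _ _ _ (by omega),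
              st_ext_of_le (N := k + 1 + M) _ _ _ _ _ (by omega),
            st_ext_of_le (N := k + 1 + M) _ _ _ _ _ (by omega)]
      simp only [h1, ← Finset.sum_mul, ← Finset.mul_sum, hPsum, mul_one, hπsum, one_mul]
    · intro τ τ' h1 h2
      apply hb
      · intro j hj
        rw [ac_ext_of_lt (N := k + 1 + M) _ _ _ _ (by omega),
              ac_ext_of_lt (N := k + 1 + M) _ _ _ _ (by omega)]
        exact h1 j hj
      · intro j hj
        rw [st_ext_of_le (N := k + 1 + M) _ _ _ _ _ (by omega),
              st_ext_of_le (N := k + 1 + M) _ _ _ _ _ (by omega)]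
        exact h2 j hj

end HCA
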